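/- With n = n_k = 2^k k, the probability that some configuration of sizes other than (k,k) occurs vanishes: lim_{k→∞} P( there exist integers k̃, l̃ ≥ 1 with (k̃, l̃) ≠ (k, k) and k̃ + l̃ < n_k such that X(k̃, l̃) > 0 ) = 0. -/

import Mathlib

open Filter Real

/-- A "configuration" in a graph `G`: two disjoint nonempty cliques `X₁, X₂` with no
edges between them, together with a vertex `x` outside both that is adjacent to every
vertex of `X₁ ∪ X₂`, such that every vertex outside `X₁ ∪ X₂` has a neighbor in `X₁`
and a neighbor in `X₂`. -/
def IsConfig {n : ℕ} (G : SimpleGraph (Fin n)) (X₁ X₂ : Finset (Fin n)) (x : Fin n) : Prop :=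
  X₁.Nonempty ∧ X₂.Nonempty ∧ Disjoint X₁ X₂ ∧
  x ∉ X₁ ∧ x ∉ X₂ ∧
  (∀ u ∈ X₁, ∀ v ∈ X₁, u ≠ v → G.Adj u v) ∧
  (∀ u ∈ X₂, ∀ v ∈ X₂, u ≠ v → G.Adj u v) ∧
  (∀ u ∈ X₁, ∀ v ∈ X₂, ¬ G.Adj u v) ∧
  (∀ u ∈ X₁, G.Adj x u) ∧ (∀ u ∈ X₂, G.Adj x u) ∧
  (∀ y : Fin n, y ∉ X₁ → y ∉ X₂ →
    (∃ u ∈ X₁, G.Adj y u) ∧ (∃ u ∈ X₂, G.Adj y u))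

/-- Property `P` of a graph: existence of a configuration. -/
def PropertyP {n : ℕ} (G : SimpleGraph (Fin n)) : Prop :=
  ∃ (X₁ X₂ : Finset (Fin n)) (x : Fin n), IsConfig G X₁ X₂ x

/-- The probability, under the uniform distribution on graphs on `{1, …, n}`,
of the set of graphs satisfying `Q`. -/
noncomputable def unifProb (n : ℕ) (Q : SimpleGraph (Fin n) → Prop) : ℝ :=
  (Nat.card {G : SimpleGraph (Fin n) // Q G} : ℝ) / 2 ^ (n.choose 2)

/-- `Xcount n k l G` is the number of ordered triples `(X₁, X₂, x)` forming a
configuration in `G` with `|X₁| = k` and `|X₂| = l`. -/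
noncomputable def Xcount (n k l : ℕ) (G : SimpleGraph (Fin n)) : ℕ :=
  Nat.card {t : Finset (Fin n) × Finset (Fin n) × Fin n //
    t.1.card = k ∧ t.2.1.card = l ∧ IsConfig G t.1 t.2.1 t.2.2}

theorem card_simpleGraph_le (V : Type*) [Fintype V] :
    Nat.card (SimpleGraph V) ≤ 2 ^ (Fintype.card V).choose 2 := by
  classical
  have hinj : Function.Injective
      (fun (G : SimpleGraph V) (e : {e : Sym2 V // ¬ e.IsDiag}) => decide (e.1 ∈ G.edgeSet)) := by
    intro G H h
    apply SimpleGraph.edgeSet_injective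
    ext e
    by_cases he : e.IsDiag
    · exact ⟨fun h' => (G.not_isDiag_of_mem_edgeSet h' he).elim,
        fun h' => (H.not_isDiag_of_mem_edgeSet h' he).elim⟩
    · simpa using congrFun h ⟨e, he⟩
  refine (Nat.card_le_card_of_injective _ hinj).trans ?_
  rw [Nat.card_eq_fintype_card, Fintype.card_fun, Fintype.card_bool, Sym2.card_subtype_not_diag]

theorem card_nonempty_subsets {α : Type*} (X : Finset α) :
    Nat.card {T : Finset α // T ⊆ X ∧ T.Nonempty} = 2 ^ X.card - 1 := by
  classical
  rw [Nat.subtype_card (X.powerset.erase ∅), Finset.card_erase_of_mem (by simp),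
    Finset.card_powerset]
  intro T
  simp [Finset.nonempty_iff_ne_empty, and_comm]

theorem card_isConfig_le {n : ℕ} (X₁ X₂ : Finset (Fin n)) (x : Fin n) :
    Nat.card {G : SimpleGraph (Fin n) // IsConfig G X₁ X₂ x} ≤
      (2 ^ X₁.card - 1) ^ (n - (X₁.card + X₂.card) - 1) *
      (2 ^ X₂.card - 1) ^ (n - (X₁.card + X₂.card) - 1) *
      2 ^ (n - (X₁.card + X₂.card)).choose 2 := by
  classical
  by_cases hx : Disjoint X₁ X₂ ∧ x ∉ X₁ ∧ x ∉ X₂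
  swap
  · have : IsEmpty {G : SimpleGraph (Fin n) // IsConfig G X₁ X₂ x} :=
      ⟨fun G => hx ⟨G.2.2.2.1, G.2.2.2.2.1, G.2.2.2.2.2.1⟩⟩
    simp
  obtain ⟨hd, hx₁, hx₂⟩ := hx
  set S := (X₁ ∪ X₂)ᶜ with hS
  have hSc : S.card = n - (X₁.card + X₂.card) := by
    rw [hS, Finset.card_compl, Finset.card_union_of_disjoint hd, Fintype.card_fin]
  have hxS : x ∈ S := by simp [hS, hx₁, hx₂]
  have hEc : (S.erase x).card = n - (X₁.card + X₂.card) - 1 := by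
    rw [Finset.card_erase_of_mem hxS, hSc]
  have hmem : ∀ y ∈ S, y ∉ X₁ ∧ y ∉ X₂ := fun y hy => by simpa [hS] using hy
  have hmemE : ∀ y ∈ S.erase x, y ∉ X₁ ∧ y ∉ X₂ :=
    fun y hy => hmem y (Finset.mem_of_mem_erase hy)
  let f : {G : SimpleGraph (Fin n) // IsConfig G X₁ X₂ x} →
      (({y // y ∈ S.erase x} → {T : Finset (Fin n) // T ⊆ X₁ ∧ T.Nonempty}) ×
       ({y // y ∈ S.erase x} → {T : Finset (Fin n) // T ⊆ X₂ ∧ T.Nonempty})) ×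
      SimpleGraph {y // y ∈ S} := fun G =>
    ((fun y => ⟨X₁.filter (G.1.Adj y.1), Finset.filter_subset _ _, by
        obtain ⟨u, hu, h⟩ :=
          (G.2.2.2.2.2.2.2.2.2.2.2 y.1 (hmemE _ y.2).1 (hmemE _ y.2).2).1
        exact ⟨u, Finset.mem_filter.2 ⟨hu, h⟩⟩⟩,
      fun y => ⟨X₂.filter (G.1.Adj y.1), Finset.filter_subset _ _, by
        obtain ⟨u, hu, h⟩ :=
          (G.2.2.2.2.2.2.2.2.2.2.2 y.1 (hmemE _ y.2).1 (hmemE _ y.2).2).2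
        exact ⟨u, Finset.mem_filter.2 ⟨hu, h⟩⟩⟩),
      G.1.comap Subtype.val)
  have hf : Function.Injective f := by
    rintro ⟨G, hG⟩ ⟨H, hH⟩ h
    have h₁ : ∀ y ∈ S, ∀ u ∈ X₁, (G.Adj y u ↔ H.Adj y u) := by
      intro y hy u hu
      by_cases hyx : y = x
      · subst hyx
        exact iff_of_true (hG.2.2.2.2.2.2.2.2.1 u hu) (hH.2.2.2.2.2.2.2.2.1 u hu)
      · have := congrArg Subtype.val
          (congrFun (congrArg (fun p => Prod.fst (Prod.fst p)) h)
            ⟨y, Finset.mem_erase.2 ⟨hyx, hy⟩⟩)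
        simpa [f, hu] using Finset.ext_iff.1 this u
    have h₂ : ∀ y ∈ S, ∀ u ∈ X₂, (G.Adj y u ↔ H.Adj y u) := by
      intro y hy u hu
      by_cases hyx : y = x
      · subst hyx
        exact iff_of_true (hG.2.2.2.2.2.2.2.2.2.1 u hu) (hH.2.2.2.2.2.2.2.2.2.1 u hu)
      · have := congrArg Subtype.val
          (congrFun (congrArg (fun p => Prod.snd (Prod.fst p)) h)
            ⟨y, Finset.mem_erase.2 ⟨hyx, hy⟩⟩)
        simpa [f, hu] using Finset.ext_iff.1 this u
    have h₃ : ∀ y ∈ S, ∀ z ∈ S, (G.Adj y z ↔ H.Adj y z) := by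
      intro y hy z hz
      have : G.comap Subtype.val = H.comap (Subtype.val : {y // y ∈ S} → Fin n) :=
        congrArg Prod.snd h
      have h' : (G.comap Subtype.val).Adj (⟨y, hy⟩ : {y // y ∈ S}) ⟨z, hz⟩ ↔
        (H.comap Subtype.val).Adj (⟨y, hy⟩ : {y // y ∈ S}) ⟨z, hz⟩ := by rw [this]
      simpa using h'
    have hcov : ∀ y, y ∈ X₁ ∨ y ∈ X₂ ∨ y ∈ S := by
      intro y
      simp only [hS, Finset.mem_compl, Finset.mem_union]
      tauto
    obtain ⟨-, -, -, -, -, g₁, g₂, g₃, -⟩ := hG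
    obtain ⟨-, -, -, -, -, k₁, k₂, k₃, -⟩ := hH
    refine Subtype.ext (SimpleGraph.ext ?_)
    funext u v
    refine propext ?_
    by_cases huv : u = v
    · subst huv
      simp
    rcases hcov u with hu | hu | hu <;> rcases hcov v with hv | hv | hv
    · exact iff_of_true (g₁ u hu v hv huv) (k₁ u hu v hv huv)
    · exact iff_of_false (g₃ u hu v hv) (k₃ u hu v hv)
    · rw [G.adj_comm, H.adj_comm]
      exact h₁ v hv u hu
    · rw [G.adj_comm, H.adj_comm]
      exact iff_of_false (g₃ v hv u hu) (k₃ v hv u hu)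
    · exact iff_of_true (g₂ u hu v hv huv) (k₂ u hu v hv huv)
    · rw [G.adj_comm, H.adj_comm]
      exact h₂ v hv u hu
    · exact h₁ u hu v hv
    · exact h₂ u hu v hv
    · exact h₃ u hu v hv
  refine (Nat.card_le_card_of_injective f hf).trans ?_
  rw [Nat.card_prod, Nat.card_prod, Nat.card_fun, Nat.card_fun, card_nonempty_subsets,
    card_nonempty_subsets, Nat.card_eq_fintype_card (α := {y // y ∈ S.erase x}),
    Fintype.card_coe, hEc]
  refine Nat.mul_le_mul_left _ ((card_simpleGraph_le _).trans ?_)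
  rw [Fintype.card_coe, hSc]

theorem two_pow_sub_one_pow_le (a m : ℕ) :
    (((2 ^ a - 1 : ℕ) : ℝ)) ^ m ≤ 2 ^ (a * m) * exp (-(m / 2 ^ a)) := by
  have h : ((2 ^ a - 1 : ℕ) : ℝ) ≤ 2 ^ a * exp (-(1 / 2 ^ a)) := by
    have h1 : 1 - (1 : ℝ) / 2 ^ a ≤ exp (-(1 / 2 ^ a)) := one_sub_le_exp_neg _
    have h2 : ((2 ^ a - 1 : ℕ) : ℝ) = 2 ^ a * (1 - 1 / 2 ^ a) := by
      rw [Nat.cast_sub Nat.one_le_two_pow]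
      push_cast
      field_simp
    rw [h2]
    gcongr
  calc (((2 ^ a - 1 : ℕ) : ℝ)) ^ m ≤ (2 ^ a * exp (-(1 / 2 ^ a))) ^ m := by gcongr
    _ = _ := by
      rw [mul_pow, ← pow_mul, ← exp_nat_mul]
      congr 2
      ring

theorem card_isConfig_div_le {n : ℕ} (X₁ X₂ : Finset (Fin n)) (x : Fin n) {a b m : ℕ}
    (ha : X₁.card = a) (hb : X₂.card = b) (hn : n = a + b + m + 1) :
    (Nat.card {G : SimpleGraph (Fin n) // IsConfig G X₁ X₂ x} : ℝ) / 2 ^ n.choose 2 ≤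
      exp (-(m / 2 ^ a)) * exp (-(m / 2 ^ b)) / 2 ^ (a + b + 1).choose 2 := by
  have h := card_isConfig_le X₁ X₂ x
  rw [ha, hb, show n - (a + b) - 1 = m by omega, show n - (a + b) = m + 1 by omega] at h
  have h' : (Nat.card {G : SimpleGraph (Fin n) // IsConfig G X₁ X₂ x} : ℝ) ≤
      (2 ^ (a * m) * exp (-(m / 2 ^ a))) * (2 ^ (b * m) * exp (-(m / 2 ^ b))) *
        2 ^ (m + 1).choose 2 := by
    refine (Nat.cast_le.2 h).trans ?_
    rw [Nat.cast_mul, Nat.cast_mul, Nat.cast_pow, Nat.cast_pow, Nat.cast_pow 2]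
    gcongr
    · exact two_pow_sub_one_pow_le a m
    · exact two_pow_sub_one_pow_le b m
    · norm_num
  have hch : n.choose 2 = a * m + b * m + (m + 1).choose 2 + (a + b + 1).choose 2 := by
    have key : ((n.choose 2 : ℕ) : ℚ) =
        ((a * m + b * m + (m + 1).choose 2 + (a + b + 1).choose 2 : ℕ) : ℚ) := by
      push_cast
      rw [Nat.cast_choose_two, Nat.cast_choose_two, Nat.cast_choose_two, hn]
      push_cast
      ring
    exact_mod_cast key
  rw [div_le_div_iff₀ (by positivity) (by positivity), hch]
  calc _ ≤ (2 ^ (a * m) * exp (-(m / 2 ^ a))) * (2 ^ (b * m) * exp (-(m / 2 ^ b))) *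
        2 ^ (m + 1).choose 2 * (2 : ℝ) ^ (a + b + 1).choose 2 := by gcongr
    _ = _ := by
      rw [pow_add, pow_add, pow_add]
      ring

theorem exponent_le {δ : ℝ} (hδ₀ : 0 ≤ δ) (hδ : δ ≤ 0.001) (k a : ℕ) :
    1 - (1 - δ) * (2 ^ k / 2 ^ a) - ((a : ℝ) - k) * log 2 ≤ δ - 0.19 * |(a : ℝ) - k| := by
  have l1 := log_two_gt_d9
  have l2 := log_two_lt_d9
  rcases le_total k a with h | h
  · obtain ⟨p, rfl⟩ := Nat.exists_eq_add_of_le h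
    have e1 : (2 : ℝ) ^ k / 2 ^ (k + p) = 1 / 2 ^ p := by
      rw [pow_add]
      field_simp
    rw [e1]
    push_cast
    rw [add_sub_cancel_left, abs_of_nonneg (Nat.cast_nonneg p)]
    rcases p with _ | _ | p
    · simp
    · norm_num
      linarith
    · have : 0 ≤ (1 - δ) * (1 / (2 : ℝ) ^ (p + 1 + 1)) :=
        mul_nonneg (by linarith) (by positivity)
      push_cast
      have hp : (0 : ℝ) ≤ p := Nat.cast_nonneg p
      nlinarith
  · obtain ⟨p, rfl⟩ := Nat.exists_eq_add_of_le h
    have e1 : (2 : ℝ) ^ (a + p) / 2 ^ a = 2 ^ p := by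
      rw [pow_add]
      field_simp
    rw [e1]
    push_cast
    rw [sub_add_cancel_left, abs_neg, abs_of_nonneg (Nat.cast_nonneg p)]
    rcases p with _ | p
    · simp
    · have h2 : (p : ℝ) + 1 ≤ 2 ^ p := by
        exact_mod_cast Nat.lt_two_pow_self (n := p)
      rw [pow_succ]
      push_cast
      have hp : (0 : ℝ) ≤ p := Nat.cast_nonneg p
      nlinarith

theorem choose_two_pow_mul_le (k a : ℕ) :
    ((2 ^ k * k).choose a : ℝ) ≤ exp (k * a * log 2 + k) := by
  calc ((2 ^ k * k).choose a : ℝ) ≤ ((2 ^ k * k : ℕ) : ℝ) ^ a / a.factorial :=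
        Nat.choose_le_pow_div _ _
    _ = 2 ^ (k * a) * ((k : ℝ) ^ a / a.factorial) := by
        push_cast
        rw [mul_pow, ← pow_mul, mul_div_assoc]
    _ ≤ 2 ^ (k * a) * exp k := by
        gcongr
        exact pow_div_factorial_le_exp _ (Nat.cast_nonneg k) a
    _ = exp (k * a * log 2 + k) := by
        rw [exp_add, mul_comm _ (log 2), exp_mul, exp_log two_pos, ← Nat.cast_mul, rpow_natCast]

theorem expected_count_le {k a b m : ℕ} (hk : 2 ≤ k) (hδ : (8 : ℝ) / 2 ^ k ≤ 0.001)
    (hkδ : k * ((8 : ℝ) / 2 ^ k) ≤ 1) (hn : 2 ^ k * k = a + b + m + 1) :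
    ((2 ^ k * k).choose a : ℝ) * (2 ^ k * k).choose b * (2 ^ k * k : ℕ) *
      (exp (-(m / 2 ^ a)) * exp (-(m / 2 ^ b)) / 2 ^ (a + b + 1).choose 2) ≤
      k * exp (2 - 0.19 * k * (|(a : ℝ) - k| + |(b : ℝ) - k|)) := by
  have l1 := log_two_gt_d9
  have hk' : (2 : ℝ) ≤ k := by exact_mod_cast hk
  have hpow : ∀ N : ℕ, (2 : ℝ) ^ N = exp (N * log 2) := fun N => by
    rw [mul_comm, exp_mul, exp_log two_pos, rpow_natCast]
  have hexp : (2 * k - k * ((a - k) + (b - k)) * log 2 - m / 2 ^ a - m / 2 ^ b : ℝ) ≤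
      2 - 0.19 * k * (|(a : ℝ) - k| + |(b : ℝ) - k|) := by
    have ma : (0 : ℝ) ≤ m / 2 ^ a := by positivity
    have mb : (0 : ℝ) ≤ m / 2 ^ b := by positivity
    rcases le_total (a + b + 1) (8 * k) with h | h
    · have hm : (k : ℝ) * ((1 - 8 / 2 ^ k) * 2 ^ k) ≤ m := by
        have e : ((1 : ℝ) - 8 / 2 ^ k) * 2 ^ k = 2 ^ k - 8 := by field_simp
        rw [e]
        have h' : (a + b + 1 : ℝ) ≤ 8 * k := by exact_mod_cast h
        have hn' : (2 ^ k * k : ℝ) = a + b + m + 1 := by exact_mod_cast hn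
        linarith
      have hdiv : ∀ c : ℕ, (k : ℝ) * ((1 - 8 / 2 ^ k) * (2 ^ k / 2 ^ c)) ≤ m / 2 ^ c := by
        intro c
        rw [← mul_div_assoc, ← mul_div_assoc]
        gcongr
      have ea := mul_le_mul_of_nonneg_left
        (exponent_le (by positivity) hδ k a) (Nat.cast_nonneg (α := ℝ) k)
      have eb := mul_le_mul_of_nonneg_left
        (exponent_le (by positivity) hδ k b) (Nat.cast_nonneg (α := ℝ) k)
      have da := hdiv a
      have db := hdiv b
      linarith
    · have h' : (8 * k : ℝ) ≤ a + b + 1 := by exact_mod_cast h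
      have hA : |(a : ℝ) - k| ≤ (a - k) + 2 * k :=
        abs_le.2 ⟨by linarith [Nat.cast_nonneg (α := ℝ) a], by linarith⟩
      have hB : |(b : ℝ) - k| ≤ (b - k) + 2 * k :=
        abs_le.2 ⟨by linarith [Nat.cast_nonneg (α := ℝ) b], by linarith⟩
      have hlin : 2 + 0.19 * (|(a : ℝ) - k| + |(b : ℝ) - k|) ≤ ((a - k) + (b - k)) * log 2 := by
        nlinarith
      nlinarith
  have hn0 : ((2 ^ k * k : ℕ) : ℝ) = k * exp (k * log 2) := by
    push_cast
    rw [hpow, mul_comm]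
  calc _ ≤ exp (k * a * log 2 + k) * exp (k * b * log 2 + k) * (k * exp (k * log 2)) *
      (exp (-(m / 2 ^ a)) * exp (-(m / 2 ^ b)) / 2 ^ (a + b + 1).choose 2) := by
        rw [hn0]
        gcongr <;> exact choose_two_pow_mul_le _ _
    _ = k * exp ((k * a * log 2 + k) + (k * b * log 2 + k) + k * log 2 + (-(m / 2 ^ a)) +
        (-(m / 2 ^ b)) - (a + b + 1 : ℕ).choose 2 * log 2) := by
        rw [exp_sub, exp_add _ (-(m / 2 ^ b) : ℝ), exp_add _ (-(m / 2 ^ a) : ℝ),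
          exp_add _ (k * log 2), exp_add (k * a * log 2 + k) (k * b * log 2 + k), hpow (Nat.choose _ _)]
        ring
    _ ≤ _ := by
        refine mul_le_mul_of_nonneg_left (exp_le_exp.2 (le_trans ?_ hexp)) (Nat.cast_nonneg k)
        rw [Nat.cast_choose_two]
        push_cast
        have ht : 0 ≤ ((a : ℝ) + b - 2 * k) * (a + b - 2 * k + 1) := by
          have : (0 : ℤ) ≤ ((a : ℤ) + b - 2 * k) * (a + b - 2 * k + 1) := by
            rcases le_or_gt 0 ((a : ℤ) + b - 2 * k) with h | h
            · exact mul_nonneg h (by omega)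
            · exact mul_nonneg_of_nonpos_of_nonpos h.le (by omega)
          exact_mod_cast this
        nlinarith [mul_nonneg ht (by linarith : (0 : ℝ) ≤ log 2)]

theorem sum_pow_natAbs_sub_le (k n : ℕ) {q : ℝ} (hq₀ : 0 ≤ q) (hq : q ≤ 1 / 2) :
    ∑ a ∈ Finset.range n, q ^ ((a : ℤ) - k).natAbs ≤ 4 := by
  have hgeom : ∀ N : ℕ, ∑ i ∈ Finset.range N, q ^ i ≤ 2 := fun N =>
    (Finset.sum_le_sum fun i _ => pow_le_pow_left₀ hq₀ hq i).trans (sum_geometric_two_le N)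
  calc ∑ a ∈ Finset.range n, q ^ ((a : ℤ) - k).natAbs
      ≤ ∑ a ∈ Finset.range (k + n), q ^ ((a : ℤ) - k).natAbs :=
        Finset.sum_le_sum_of_subset_of_nonneg (by simp) fun _ _ _ => by positivity
    _ = ∑ a ∈ Finset.range k, q ^ ((a : ℤ) - k).natAbs + ∑ i ∈ Finset.range n, q ^ i := by
        rw [Finset.sum_range_add]
        congr 1
        refine Finset.sum_congr rfl fun i _ => ?_
        congr 1
        omega
    _ ≤ 2 + 2 := by
        refine add_le_add ?_ (hgeom n)
        rw [← Finset.sum_range_reflect]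
        refine (Finset.sum_le_sum fun i hi => ?_).trans (hgeom k)
        have := Finset.mem_range.1 hi
        exact pow_le_pow_of_le_one hq₀ (by linarith) (by omega)
    _ = 4 := by norm_num

theorem unifProb_exists_le {n : ℕ} (I : Finset (ℕ × ℕ)) (c : ℕ × ℕ → ℝ)
    (hc : ∀ p ∈ I, ∀ X₁ X₂ : Finset (Fin n), X₁.card = p.1 → X₂.card = p.2 → ∀ x,
      unifProb n (fun G => IsConfig G X₁ X₂ x) ≤ c p) :
    unifProb n (fun G => ∃ p ∈ I, 0 < Xcount n p.1 p.2 G) ≤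
      ∑ p ∈ I, (n.choose p.1 : ℝ) * n.choose p.2 * n * c p := by
  classical
  let T : ℕ × ℕ → Finset (Finset (Fin n) × Finset (Fin n) × Fin n) := fun p =>
    Finset.univ.powersetCard p.1 ×ˢ Finset.univ.powersetCard p.2 ×ˢ Finset.univ
  have hprob : ∀ Q : SimpleGraph (Fin n) → Prop,
      unifProb n Q = (Finset.univ.filter Q).card / 2 ^ n.choose 2 := fun Q => by
    rw [unifProb, Nat.card_eq_fintype_card, Fintype.card_subtype]
  have hsub : Finset.univ.filter (fun G => ∃ p ∈ I, 0 < Xcount n p.1 p.2 G) ⊆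
      I.biUnion fun p => (T p).biUnion fun t =>
        Finset.univ.filter fun G => IsConfig G t.1 t.2.1 t.2.2 := by
    intro G hG
    obtain ⟨p, hp, h⟩ := (Finset.mem_filter.1 hG).2
    obtain ⟨⟨t, h₁, h₂, h₃⟩⟩ := (Nat.card_pos_iff.1 h).1
    refine Finset.mem_biUnion.2 ⟨p, hp, Finset.mem_biUnion.2 ⟨t, ?_, by simpa using h₃⟩⟩
    simp [T, h₁, h₂]
  have hcard : (Finset.univ.filter (fun G => ∃ p ∈ I, 0 < Xcount n p.1 p.2 G)).card ≤
      ∑ p ∈ I, ∑ t ∈ T p, (Finset.univ.filter fun G => IsConfig G t.1 t.2.1 t.2.2).card :=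
    (Finset.card_le_card hsub).trans <| Finset.card_biUnion_le.trans <|
      Finset.sum_le_sum fun p _ => Finset.card_biUnion_le
  rw [hprob]
  calc _ ≤ ((∑ p ∈ I, ∑ t ∈ T p,
        (Finset.univ.filter fun G => IsConfig G t.1 t.2.1 t.2.2).card : ℕ) : ℝ) /
          2 ^ n.choose 2 := by
        refine div_le_div_of_nonneg_right (Nat.cast_le.2 (le_trans (le_of_eq ?_) hcard))
          (by positivity)
        congr!
    _ = ∑ p ∈ I, ∑ t ∈ T p, unifProb n (fun G => IsConfig G t.1 t.2.1 t.2.2) := by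
        simp only [hprob, Nat.cast_sum, Finset.sum_div]
    _ ≤ ∑ p ∈ I, ∑ t ∈ T p, c p := by
        refine Finset.sum_le_sum fun p hp => Finset.sum_le_sum fun t ht => ?_
        simp only [T, Finset.mem_product, Finset.mem_powersetCard] at ht
        exact hc p hp _ _ ht.1.2 ht.2.1.2 _
    _ = _ := by
        refine Finset.sum_congr rfl fun p _ => ?_
        rw [Finset.sum_const, nsmul_eq_mul]
        simp only [T, Finset.card_product, Finset.card_powersetCard, Finset.card_univ,
          Fintype.card_fin]
        push_cast
        ring

theorem prob_other_sizes_le {k : ℕ} (hk : 10 ≤ k) (hδ : (8 : ℝ) / 2 ^ k ≤ 0.001)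
    (hkδ : k * ((8 : ℝ) / 2 ^ k) ≤ 1) :
    unifProb (2 ^ k * k)
        (fun G => ∃ kt lt : ℕ, 1 ≤ kt ∧ 1 ≤ lt ∧ (kt, lt) ≠ (k, k) ∧
          kt + lt < 2 ^ k * k ∧ 0 < Xcount (2 ^ k * k) kt lt G) ≤
      16 * exp 2 * (k * exp (-0.095 * k)) := by
  classical
  set n := 2 ^ k * k with hn
  set q := exp (-0.095 * k) with hq
  have hq₀ : 0 ≤ q := (exp_pos _).le
  have hq₁ : q ≤ 1 / 2 := by
    have h1 : -0.095 * (k : ℝ) ≤ -log 2 := by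
      have : (10 : ℝ) ≤ k := by exact_mod_cast hk
      linarith [log_two_lt_d9]
    calc q ≤ exp (-log 2) := exp_le_exp.2 h1
      _ = 1 / 2 := by rw [exp_neg, exp_log two_pos, one_div]
  let d : ℕ → ℕ := fun a => ((a : ℤ) - k).natAbs
  let I : Finset (ℕ × ℕ) := (Finset.range n ×ˢ Finset.range n).filter
    fun p => p ≠ (k, k) ∧ p.1 + p.2 < n
  have hQ : (fun G => ∃ kt lt : ℕ, 1 ≤ kt ∧ 1 ≤ lt ∧ (kt, lt) ≠ (k, k) ∧
      kt + lt < n ∧ 0 < Xcount n kt lt G) ≤ fun G => ∃ p ∈ I, 0 < Xcount n p.1 p.2 G := by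
    rintro G ⟨a, b, -, -, hne, hlt, hX⟩
    refine ⟨(a, b), ?_, hX⟩
    simp only [I, Finset.mem_filter, Finset.mem_product, Finset.mem_range]
    exact ⟨⟨by omega, by omega⟩, hne, hlt⟩
  have hmono : ∀ {Q R : SimpleGraph (Fin n) → Prop}, Q ≤ R → unifProb n Q ≤ unifProb n R := by
    intro Q R h
    unfold unifProb
    gcongr
    exact Nat.card_le_card_of_injective _ (Subtype.map_injective h Function.injective_id)
  refine (hmono hQ).trans ((unifProb_exists_le I
    (fun p => exp (-((n - p.1 - p.2 - 1 : ℕ) / 2 ^ p.1)) *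
      exp (-((n - p.1 - p.2 - 1 : ℕ) / 2 ^ p.2)) / 2 ^ (p.1 + p.2 + 1).choose 2) ?_).trans ?_)
  · intro p hp X₁ X₂ h₁ h₂ x
    have := (Finset.mem_filter.1 hp).2.2
    exact card_isConfig_div_le X₁ X₂ x h₁ h₂ (by omega)
  · calc _ ≤ ∑ p ∈ I, k * exp 2 * q * (q ^ d p.1 * q ^ d p.2) := by
          refine Finset.sum_le_sum fun p hp => ?_
          obtain ⟨-, hne, hlt⟩ := Finset.mem_filter.1 hp
          refine (expected_count_le (by omega) hδ hkδ (by omega)).trans ?_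
          have hd : ∀ a : ℕ, |(a : ℝ) - k| = d a := fun a => by
            simp only [d, Nat.cast_natAbs]
            push_cast
            rfl
          have hpos : 1 ≤ d p.1 + d p.2 := by
            by_contra h
            exact hne (Prod.ext (by simp only [d] at h ⊢; omega) (by simp only [d] at h ⊢; omega))
          have hpos' : (1 : ℝ) ≤ d p.1 + d p.2 := by exact_mod_cast hpos
          rw [hd, hd, hq, ← exp_nat_mul, ← exp_nat_mul, ← exp_add,
            mul_assoc (k * exp 2 : ℝ), ← exp_add, mul_assoc (k : ℝ), ← exp_add]
          refine mul_le_mul_of_nonneg_left (exp_le_exp.2 ?_) (Nat.cast_nonneg k)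
          nlinarith [Nat.cast_nonneg (α := ℝ) k]
    _ ≤ ∑ p ∈ Finset.range n ×ˢ Finset.range n, k * exp 2 * q * (q ^ d p.1 * q ^ d p.2) :=
          Finset.sum_le_sum_of_subset_of_nonneg (Finset.filter_subset _ _)
            fun _ _ _ => by positivity
    _ = k * exp 2 * q * ((∑ a ∈ Finset.range n, q ^ d a) * ∑ b ∈ Finset.range n, q ^ d b) := by
          rw [← Finset.mul_sum, Finset.sum_mul_sum, Finset.sum_product]
    _ ≤ k * exp 2 * q * (4 * 4) := by
          have := sum_pow_natAbs_sub_le k n hq₀ hq₁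
          gcongr
    _ = _ := by ring

/-- With `n_k = 2^k k`, the probability that some configuration of
sizes other than `(k,k)` occurs vanishes as `k → ∞`. -/
theorem prob_other_sizes_tendsto_zero :
    Tendsto (fun k : ℕ => unifProb (2 ^ k * k)
        (fun G => ∃ kt lt : ℕ, 1 ≤ kt ∧ 1 ≤ lt ∧ (kt, lt) ≠ (k, k) ∧
          kt + lt < 2 ^ k * k ∧ 0 < Xcount (2 ^ k * k) kt lt G))
      atTop (nhds 0) := by
  have hlim₁ : Tendsto (fun k : ℕ => (8 : ℝ) / 2 ^ k) atTop (nhds 0) :=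
    tendsto_const_nhds.div_atTop (tendsto_pow_atTop_atTop_of_one_lt one_lt_two)
  have hlim₂ : Tendsto (fun k : ℕ => k * ((8 : ℝ) / 2 ^ k)) atTop (nhds 0) := by
    have h := (tendsto_pow_const_div_const_pow_of_one_lt 1 (one_lt_two (α := ℝ))).const_mul 8
    rw [mul_zero] at h
    exact h.congr fun k => by ring
  have hlim₃ : Tendsto (fun k : ℕ => 16 * exp 2 * (k * exp (-0.095 * k))) atTop (nhds 0) := by
    have h := ((tendsto_rpow_mul_exp_neg_mul_atTop_nhds_zero 1 0.095 (by norm_num)).comp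
      tendsto_natCast_atTop_atTop).const_mul (16 * exp 2)
    rw [mul_zero] at h
    exact h.congr fun k => by simp
  refine tendsto_of_tendsto_of_tendsto_of_le_of_le' tendsto_const_nhds hlim₃
    (Eventually.of_forall fun k => by unfold unifProb; positivity) ?_
  filter_upwards [eventually_ge_atTop 10, hlim₁.eventually_le_const (by norm_num : (0 : ℝ) < 0.001),
    hlim₂.eventually_le_const one_pos] with k hk h₁ h₂
  exact prob_other_sizes_le hk h₁ h₂
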